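/- arXiv:1502.05123 — 2 statements merged into one kernel-verified Lean document; each statement's English description precedes it below -/
import Mathlib

section
/- Let c ∈ ℂ with Re c > 0, let 0 < α ≤ 1, and let n be a positive integer. If a function q ∈ H[c^α, n] satisfies q(z) ≠ 0 for all z ∈ 𝔻 and the function z ↦ q(z) + z·q′(z)/q(z) is subordinate to R_{α,c,n}, then q is subordinate to g_c^α. -/
open Complex Metric Set

/-- `g_c(z) = (c + c̄z)/(1 − z)`. -/
noncomputable def gc (c : ℂ) (z : ℂ) : ℂ := (c + (starRingEnd ℂ) c * z) / (1 - z)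

/-- The generalized open door function `R_{α,c,n}(z) = g_c(z)^α + nα z g_c'(z)/g_c(z)`. -/
noncomputable def Rgen (α : ℝ) (c : ℂ) (n : ℕ) (z : ℂ) : ℂ :=
  gc c z ^ (α : ℂ) +
    2 * (n : ℂ) * (α : ℂ) * (c.re : ℂ) * z / ((1 - z) * (c + (starRingEnd ℂ) c * z))

/-- `f` is subordinate to `F`: there is a holomorphic `ω : 𝔻 → 𝔻` with `ω(0) = 0`
and `f = F ∘ ω` on `𝔻`. -/
def Subordinate (f F : ℂ → ℂ) : Prop :=
  ∃ ω : ℂ → ℂ, DifferentiableOn ℂ ω (ball 0 1) ∧ ω 0 = 0 ∧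
    (∀ z ∈ ball (0 : ℂ) 1, ω z ∈ ball (0 : ℂ) 1) ∧
    ∀ z ∈ ball (0 : ℂ) 1, f z = F (ω z)

open Filter Topology ComplexConjugate

theorem re_div_sub_pos_of_hasDerivAt {h h' : ℂ → ℂ} (hh : ∀ z, HasDerivAt h (h' z) z)
    {v v₀ : ℂ} (hne : v₀ ≠ v)
    (hpos : ∀ t : ℝ, 0 < t → t < 1 → 0 < (h' (v + t * (v₀ - v))).re) :
    0 < ((h v₀ - h v) / (v₀ - v)).re := by
  have hδ : v₀ - v ≠ 0 := sub_ne_zero.2 hne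
  have hd : ∀ t : ℝ, HasDerivAt (fun t : ℝ => (h (v + t * (v₀ - v)) / (v₀ - v)).re)
      (h' (v + t * (v₀ - v))).re t := by
    intro t
    have h1 : HasDerivAt (fun s : ℂ => v + s * (v₀ - v)) (v₀ - v) (t : ℂ) := by
      simpa using ((hasDerivAt_id (t : ℂ)).mul_const (v₀ - v)).const_add v
    have h2 := ((hh (v + t * (v₀ - v))).comp (t : ℂ) h1).div_const (v₀ - v)
    rw [mul_div_cancel_right₀ _ hδ] at h2
    exact h2.real_of_complex
  have hmono := strictMonoOn_of_deriv_pos (convex_Icc (0 : ℝ) 1)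
    (fun t _ => (hd t).continuousAt.continuousWithinAt) (fun t ht => by
      rw [interior_Icc] at ht
      rw [(hd t).deriv]
      exact hpos t ht.1 ht.2)
  have := hmono (left_mem_Icc.2 zero_le_one) (right_mem_Icc.2 zero_le_one) zero_lt_one
  simpa [sub_div] using this

theorem abs_im_segment_lt {v v₀ : ℂ} {b : ℝ} (hv₀ : |v₀.im| ≤ b) (hv : |v.im| < b) {t : ℝ}
    (ht0 : 0 < t) (ht1 : t < 1) : |(v + t * (v₀ - v)).im| < b := by
  have : (v + t * (v₀ - v)).im = (1 - t) * v.im + t * v₀.im := by simp; ring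
  rw [this]
  rw [abs_lt] at *
  rw [abs_le] at hv₀
  constructor <;> nlinarith

theorem re_exp_pos {z : ℂ} (hz : |z.im| < Real.pi / 2) : 0 < (exp z).re := by
  rw [exp_re]
  exact mul_pos (Real.exp_pos _) (Real.cos_pos_of_mem_Ioo (abs_lt.1 hz))

theorem re_exp_nonneg {z : ℂ} (hz : |z.im| ≤ Real.pi / 2) : 0 ≤ (exp z).re := by
  rw [exp_re]
  exact mul_nonneg (Real.exp_pos _).le (Real.cos_nonneg_of_mem_Icc (abs_le.1 hz))

theorem normSq_add_conj_sub_normSq_sub (w c : ℂ) :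
    normSq (w + conj c) - normSq (w - c) = 4 * w.re * c.re := by
  simp [normSq_apply]
  ring

theorem add_conj_ne_zero {w c : ℂ} (hw : 0 ≤ w.re) (hc : 0 < c.re) : w + conj c ≠ 0 := by
  intro h
  have := congrArg re h
  simp at this
  linarith

/-- `ζ g_c'(ζ) / g_c(ζ)` expressed in terms of `w = g_c(ζ)`. -/
noncomputable def gcLogDeriv (c w : ℂ) : ℂ := (w - c) * (w + conj c) / (2 * c.re * w)

/-- `R_{α,c,n}` in the coordinate `v = log g_c(z)`. -/
noncomputable def stripR (α : ℝ) (c : ℂ) (n : ℝ) (v : ℂ) : ℂ :=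
  exp (α * v) + n * α * gcLogDeriv c (exp v)

theorem stripR_eq (α : ℝ) {c : ℂ} (hc : 0 < c.re) (n : ℝ) (v : ℂ) :
    stripR α c n v = exp (α * v) +
      (n * α / (2 * c.re) : ℝ) * (exp v - normSq c * exp (-v) - 2 * c.im * I) := by
  have hc' : (c.re : ℂ) ≠ 0 := by exact_mod_cast hc.ne'
  have h1 : conj c = c - 2 * c.im * I := by
    apply Complex.ext <;> simp
    ring
  rw [stripR, gcLogDeriv, exp_neg, ← mul_conj, h1]
  push_cast
  field_simp [exp_ne_zero v]
  ring

theorem hasDerivAt_stripR (α : ℝ) {c : ℂ} (hc : 0 < c.re) (n : ℝ) (v : ℂ) :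
    HasDerivAt (stripR α c n) (α * exp (α * v) +
      (n * α / (2 * c.re) : ℝ) * (exp v + normSq c * exp (-v))) v := by
  rw [funext (stripR_eq α hc n)]
  have h1 : HasDerivAt (fun v : ℂ => exp (α * v)) (exp (α * v) * (α * 1)) v :=
    ((hasDerivAt_id v).const_mul (α : ℂ)).cexp
  have h2 : HasDerivAt (fun v : ℂ => exp (-v)) (exp (-v) * -1) v := (hasDerivAt_id v).neg.cexp
  convert! h1.add ((((hasDerivAt_exp v).sub (h2.const_mul (normSq c : ℂ))).sub_const
    (2 * c.im * I)).const_mul ((n * α / (2 * c.re) : ℝ) : ℂ)) using 1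
  ring

theorem gcLogDeriv_mul_I {c : ℂ} (hc : 0 < c.re) {y : ℝ} (hy : y ≠ 0) :
    gcLogDeriv c (y * I) = (((y - c.im) ^ 2 + c.re ^ 2) / (2 * c.re * y) : ℝ) * I := by
  have hc' : (c.re : ℂ) ≠ 0 := by exact_mod_cast hc.ne'
  have hy' : (y : ℂ) ≠ 0 := by exact_mod_cast hy
  have h1 : c = c.re + c.im * I := (re_add_im c).symm
  have h2 : conj c = c.re - c.im * I := by
    apply Complex.ext <;> simp
  rw [gcLogDeriv, h2, div_eq_iff (by simp [hc', hy'])]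
  nth_rewrite 1 [h1]
  push_cast
  field_simp
  ring_nf
  simp only [I_sq]
  ring

theorem exp_eq_mul_I {v : ℂ} (hv : |v.im| = Real.pi / 2) :
    exp v = (Real.exp v.re * Real.sin v.im : ℝ) * I := by
  have hcos : Real.cos v.im = 0 := by
    rw [← Real.cos_abs, hv, Real.cos_pi_div_two]
  apply Complex.ext
  · simp [exp_re, hcos]
  · rw [exp_im, im_ofReal_mul, I_im, mul_one]

theorem stripR_ne_of_abs_im_eq {α : ℝ} (hα : 0 < α) (hα1 : α ≤ 1) {c : ℂ} (hc : 0 < c.re)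
    {n m : ℝ} (hn : 0 ≤ n) (hnm : n ≤ m) {v v₀ : ℂ} (hv₀ : |v₀.im| = Real.pi / 2)
    (hv : |v.im| < Real.pi / 2) : stripR α c m v₀ ≠ stripR α c n v := by
  intro heq
  have hne : v₀ ≠ v := by
    rintro rfl
    exact hv.ne hv₀
  have hpos := re_div_sub_pos_of_hasDerivAt (hasDerivAt_stripR α hc n) hne (fun t ht0 ht1 => by
    have him := abs_im_segment_lt hv₀.le hv ht0 ht1
    generalize v + t * (v₀ - v) = z at him
    have hαz : |(α * z).im| < Real.pi / 2 := by
      rw [im_ofReal_mul, abs_mul, abs_of_pos hα]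
      exact (mul_le_of_le_one_left (abs_nonneg _) hα1).trans_lt him
    have h1 := re_exp_pos hαz
    have h2 := re_exp_pos him
    have h3 := re_exp_pos (z := -z) (by simpa using him)
    have h4 := normSq_nonneg c
    rw [add_re, re_ofReal_mul, re_ofReal_mul, add_re, re_ofReal_mul]
    positivity)
  set δ := v₀ - v with hδ
  have hδ0 : δ ≠ 0 := sub_ne_zero.2 hne
  have hdiff : stripR α c n v₀ - stripR α c n v =
      ((n - m) * α : ℝ) * gcLogDeriv c (exp v₀) := by
    rw [← heq, stripR, stripR]
    push_cast
    ring
  have hsin : Real.sin v₀.im ≠ 0 ∧ 0 ≤ δ.im / Real.sin v₀.im := by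
    rw [abs_lt] at hv
    rcases eq_or_eq_neg_of_abs_eq hv₀ with h | h
    · rw [h, hδ, sub_im, Real.sin_pi_div_two, div_one]
      exact ⟨one_ne_zero, by linarith⟩
    · rw [h, hδ, sub_im, Real.sin_neg, Real.sin_pi_div_two, div_neg, div_one]
      exact ⟨neg_ne_zero.2 one_ne_zero, by linarith⟩
  rw [hdiff, exp_eq_mul_I hv₀, gcLogDeriv_mul_I hc (mul_ne_zero (Real.exp_ne_zero _) hsin.1),
    ← mul_assoc, ← ofReal_mul, mul_div_assoc, re_ofReal_mul] at hpos
  have hI : (I / δ).re = δ.im / normSq δ := by simp [div_re]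
  rw [hI] at hpos
  have hδn := normSq_pos.2 hδ0
  set Q := (Real.exp v₀.re * Real.sin v₀.im - c.im) ^ 2 + c.re ^ 2 with hQ
  have hfac : (n - m) * α * (Q / (2 * c.re * (Real.exp v₀.re * Real.sin v₀.im))) *
      (δ.im / normSq δ) = -((m - n) * α * Q / (2 * c.re * Real.exp v₀.re * normSq δ) *
        (δ.im / Real.sin v₀.im)) := by
    have := hsin.1
    field_simp
    ring
  rw [hfac] at hpos
  have hQ0 : 0 ≤ Q := by positivity
  have hmn : 0 ≤ m - n := sub_nonneg.2 hnm
  have := mul_nonneg (div_nonneg (mul_nonneg (mul_nonneg hmn hα.le) hQ0)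
    (mul_pos (mul_pos (mul_pos two_pos hc) (Real.exp_pos v₀.re)) hδn).le) hsin.2
  linarith

/-- **Jack's lemma**: at a point of maximum modulus on a circle of a function with a zero of order
at least `N + 1` at the origin, the logarithmic derivative is real and at least `N + 1`. -/
theorem exists_mul_deriv_eq_of_norm_eq_one {ψ : ℂ → ℂ} {ψ' z₀ : ℂ} {N : ℕ} (hz₀ : z₀ ≠ 0)
    (hd : DifferentiableOn ℂ ψ (ball 0 ‖z₀‖)) (hψ' : HasDerivAt ψ ψ' z₀)
    (hle : ∀ z ∈ closedBall (0 : ℂ) ‖z₀‖, ‖ψ z‖ ≤ 1) (hψ₀ : ψ 0 = 0)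
    (hψN : ψ =o[𝓝 0] fun z => ‖z‖ ^ N) (hone : ‖ψ z₀‖ = 1) :
    ∃ m : ℝ, (N + 1 : ℝ) ≤ m ∧ z₀ * ψ' = m * ψ z₀ := by
  have hr : 0 < ‖z₀‖ := norm_pos_iff.2 hz₀
  have hψz : ψ z₀ ≠ 0 := norm_ne_zero_iff.1 (by rw [hone]; exact one_ne_zero)
  have hschwarz : ∀ z ∈ ball (0 : ℂ) ‖z₀‖, ‖ψ z‖ ≤ (‖z‖ / ‖z₀‖) ^ (N + 1) := by
    intro z hz
    have := dist_le_mul_div_pow_of_mapsTo_ball_of_isLittleO (n := N) (R₂ := 1) hd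
      (fun w hw => by simpa [hψ₀] using hle w (ball_subset_closedBall hw))
      (by simpa [hψ₀] using hψN) hz
    simpa [hψ₀] using this
  have hcurve : ∀ ξ : ℂ, HasDerivAt (fun t : ℝ => ψ (z₀ * exp (t * ξ)) / ψ z₀)
      (ξ * (z₀ * ψ' / ψ z₀)) 0 := by
    intro ξ
    have h1 : HasDerivAt (fun t : ℝ => z₀ * exp (t * ξ)) (z₀ * ξ) 0 := by
      simpa using (((hasDerivAt_id (0 : ℝ)).ofReal_comp.mul_const ξ).cexp).const_mul z₀
    have h2 := (HasDerivAt.comp_of_eq (0 : ℝ) hψ' h1 (by simp)).div_const (ψ z₀)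
    convert! h2 using 1
    ring
  have hre : ∀ ξ : ℂ, HasDerivAt (fun t : ℝ => (ψ (z₀ * exp (t * ξ)) / ψ z₀).re)
      (ξ * (z₀ * ψ' / ψ z₀)).re 0 := fun ξ =>
    reCLM.hasFDerivAt.comp_hasDerivAt (0 : ℝ) (hcurve ξ)
  have hbound : ∀ z, (ψ z / ψ z₀).re ≤ ‖ψ z‖ := fun z =>
    (re_le_norm _).trans_eq (by rw [norm_div, hone, div_one])
  have him : (I * (z₀ * ψ' / ψ z₀)).re = 0 := by
    refine IsLocalMax.hasDerivAt_eq_zero (Eventually.of_forall fun t => ?_) (hre I)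
    refine (hbound _).trans ((hle _ ?_).trans_eq ?_)
    · simp [norm_exp_ofReal_mul_I]
    · simp [hψz]
  have hrad : (N + 1 : ℝ) ≤ (z₀ * ψ' / ψ z₀).re := by
    have h1 : HasDerivAt (fun t : ℝ => Real.exp ((N + 1) * t)) (N + 1) 0 := by
      simpa using ((hasDerivAt_id (0 : ℝ)).const_mul (N + 1 : ℝ)).exp
    have h2 := (hre 1).sub h1
    rw [one_mul] at h2
    have hmax : IsLocalMaxOn (fun t : ℝ => (ψ (z₀ * exp (t * 1)) / ψ z₀).re -
        Real.exp ((N + 1) * t)) (Iic 0) 0 := by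
      filter_upwards [self_mem_nhdsWithin] with t ht
      rcases (mem_Iic.1 ht).eq_or_lt with rfl | ht
      · rfl
      · have hnorm : ‖z₀ * exp (t * 1)‖ = ‖z₀‖ * Real.exp t := by simp [norm_exp]
        have h3 := hschwarz (z₀ * exp (t * 1)) (by
          rw [mem_ball_zero_iff, hnorm]
          exact mul_lt_of_lt_one_right hr (Real.exp_lt_one_iff.2 ht))
        rw [hnorm, mul_div_cancel_left₀ _ hr.ne', ← Real.exp_nat_mul] at h3
        push_cast at h3
        have := (hbound _).trans h3
        simpa [hψz] using this
    have h3 := hmax.hasFDerivWithinAt_nonpos h2.hasFDerivAt.hasFDerivWithinAt (y := -1)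
      (mem_posTangentConeAt_of_segment_subset (by
        rw [zero_add, segment_symm, segment_eq_Icc (by norm_num)]
        exact Icc_subset_Iic_self))
    simp at h3
    linarith
  refine ⟨(z₀ * ψ' / ψ z₀).re, hrad, ?_⟩
  rw [← div_eq_iff hψz]
  apply Complex.ext
  · simp
  · simpa using him

theorem exists_exp_mul_eq_of_ne_zero {q : ℂ → ℂ} (hq : DifferentiableOn ℂ q (ball 0 1))
    (hne : ∀ z ∈ ball (0 : ℂ) 1, q z ≠ 0) {a b : ℂ} (ha : a ≠ 0) (hb : exp (a * b) = q 0) :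
    ∃ u : ℂ → ℂ, u 0 = b ∧ (∀ z ∈ ball (0 : ℂ) 1, HasDerivAt u (deriv q z / (a * q z)) z) ∧
      ∀ z ∈ ball (0 : ℂ) 1, exp (a * u z) = q z := by
  have h0 : (0 : ℂ) ∈ ball (0 : ℂ) 1 := mem_ball_self one_pos
  have hd : DifferentiableOn ℂ (fun z => deriv q z / (a * q z)) (ball 0 1) :=
    (hq.deriv isOpen_ball).div (hq.const_mul a) fun z hz => mul_ne_zero ha (hne z hz)
  obtain ⟨u, hu0, hu⟩ := hd.isExactOn_ball.with_val_at 0 b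
  refine ⟨u, hu0, hu, fun z hz => ?_⟩
  have hderiv : ∀ z ∈ ball (0 : ℂ) 1, HasDerivAt (fun z => exp (a * u z) / q z) 0 z := by
    intro z hz
    have h1 := (((hu z hz).const_mul a).cexp).div
      (hq.differentiableAt (isOpen_ball.mem_nhds hz)).hasDerivAt (hne z hz)
    convert! h1 using 1
    have := hne z hz
    field_simp
    ring
  have hconst := isOpen_ball.is_const_of_deriv_eq_zero (convex_ball (0 : ℂ) 1).isPreconnected
    (fun z hz => (hderiv z hz).differentiableAt.differentiableWithinAt)
    (fun z hz => (hderiv z hz).deriv) hz h0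
  simp only [hu0, hb, div_self (hne 0 h0)] at hconst
  exact (div_eq_one_iff_eq (hne z hz)).1 hconst

theorem isBigO_sub_pow_of_iteratedDeriv_eq_zero {q : ℂ → ℂ} {a : ℂ} (hq : AnalyticAt ℂ q a) {n : ℕ}
    (hk : ∀ k : ℕ, 1 ≤ k → k < n → iteratedDeriv k q a = 0) :
    (fun z => q z - q a) =O[𝓝 a] fun z => (z - a) ^ n := by
  have hqa : AnalyticAt ℂ (fun z => q z - q a) a := hq.sub analyticAt_const
  have hle : (n : ℕ∞) ≤ analyticOrderAt (fun z => q z - q a) a := by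
    refine (natCast_le_analyticOrderAt_iff_iteratedDeriv_eq_zero hqa).2 fun k hkn => ?_
    rcases Nat.eq_zero_or_pos k with rfl | hk0
    · simp
    · rw [iteratedDeriv_fun_sub hq.contDiffAt contDiffAt_const, hk k hk0 hkn,
        iteratedDeriv_const, if_neg hk0.ne', sub_zero]
  obtain ⟨g, hg, hqg⟩ := (natCast_le_analyticOrderAt hqa).1 hle
  refine (EventuallyEq.isBigO hqg).trans ?_
  simpa using (Asymptotics.isBigO_refl (fun z : ℂ => (z - a) ^ n) (𝓝 a)).mul
    (hg.continuousAt.isBigO_one ℂ)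

theorem gc_re_pos {c : ℂ} (hc : 0 < c.re) {z : ℂ} (hz : z ∈ ball (0 : ℂ) 1) :
    0 < (gc c z).re := by
  have hz1 : normSq z < 1 := by
    rw [normSq_eq_norm_sq]
    exact pow_lt_one₀ (norm_nonneg _) (mem_ball_zero_iff.1 hz) two_ne_zero
  have h1 : (1 : ℂ) - z ≠ 0 := sub_ne_zero.2 fun h => by simp [← h] at hz1
  have h2 : (gc c z).re = c.re * (1 - normSq z) / normSq (1 - z) := by
    rw [gc, div_re, ← add_div]
    congr 1
    simp [normSq_apply]
    ring
  rw [h2]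
  exact div_pos (mul_pos hc (sub_pos.2 hz1)) (normSq_pos.2 h1)

theorem gc_div_add_conj {c w : ℂ} (hc : 0 < c.re) (hw : 0 < w.re) :
    gc c ((w - c) / (w + conj c)) = w := by
  have h1 := add_conj_ne_zero hw.le hc
  have h2 : c + conj c ≠ 0 := add_conj_ne_zero hc.le hc
  have h3 : (1 : ℂ) - (w - c) / (w + conj c) ≠ 0 := by
    rw [one_sub_div h1]
    exact div_ne_zero (by simpa [add_comm] using h2) h1
  rw [gc, div_eq_iff h3]
  field_simp
  ring

theorem Rgen_eq_stripR {α : ℝ} {c : ℂ} (hc : 0 < c.re) (n : ℕ) {z : ℂ}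
    (hz : z ∈ ball (0 : ℂ) 1) : Rgen α c n z = stripR α c n (log (gc c z)) := by
  have hw := gc_re_pos hc hz
  have hw0 : gc c z ≠ 0 := fun h => by simp [h] at hw
  have hc' : (c.re : ℂ) ≠ 0 := by exact_mod_cast hc.ne'
  have hz1 : (1 : ℂ) - z ≠ 0 := fun h => hw0 (by rw [gc, h, div_zero])
  have hcz : c + conj c * z ≠ 0 := fun h => hw0 (by rw [gc, h, zero_div])
  have hcc : c + conj c = 2 * c.re := by rw [add_conj]; push_cast; rfl
  have h1 : gc c z - c = 2 * c.re * z / (1 - z) := by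
    rw [gc, ← hcc]
    field_simp
    ring
  have h2 : gc c z + conj c = 2 * c.re / (1 - z) := by
    rw [gc, ← hcc]
    field_simp
    ring
  rw [Rgen, stripR, exp_log hw0, gcLogDeriv, h1, h2, cpow_def_of_ne_zero hw0, mul_comm (log _)]
  congr 1
  rw [gc]
  push_cast
  field_simp

/-- The map `v ↦ (e^v - c) / (e^v + c̄)` of the strip `|Im v| < π/2` onto the disk, inverse to
`log g_c`. -/
noncomputable def stripToDisk (c v : ℂ) : ℂ := (exp v - c) / (exp v + conj c)

theorem norm_stripToDisk_lt_one {c v : ℂ} (hc : 0 < c.re) (hv : |v.im| < Real.pi / 2) :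
    ‖stripToDisk c v‖ < 1 := by
  have h0 := norm_pos_iff.2 (add_conj_ne_zero (re_exp_pos hv).le hc)
  rw [stripToDisk, norm_div, div_lt_one h0]
  refine lt_of_pow_lt_pow_left₀ 2 h0.le ?_
  rw [← normSq_eq_norm_sq, ← normSq_eq_norm_sq]
  have := normSq_add_conj_sub_normSq_sub (exp v) c
  nlinarith [mul_pos (re_exp_pos hv) hc]

theorem norm_stripToDisk_le_one {c v : ℂ} (hc : 0 < c.re) (hv : |v.im| ≤ Real.pi / 2) :
    ‖stripToDisk c v‖ ≤ 1 := by
  have h0 := norm_pos_iff.2 (add_conj_ne_zero (re_exp_nonneg hv) hc)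
  rw [stripToDisk, norm_div, div_le_one h0]
  refine le_of_sq_le_sq ?_ h0.le
  rw [← normSq_eq_norm_sq, ← normSq_eq_norm_sq]
  have := normSq_add_conj_sub_normSq_sub (exp v) c
  nlinarith [mul_nonneg (re_exp_nonneg hv) hc.le]

theorem norm_stripToDisk_eq_one {c v : ℂ} (hc : 0 < c.re) (hv : |v.im| = Real.pi / 2) :
    ‖stripToDisk c v‖ = 1 := by
  have h0 := norm_pos_iff.2 (add_conj_ne_zero (re_exp_nonneg hv.le) hc)
  rw [stripToDisk, norm_div, div_eq_one_iff_eq h0.ne']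
  refine (sq_eq_sq₀ (norm_nonneg _) h0.le).1 ?_
  rw [← normSq_eq_norm_sq, ← normSq_eq_norm_sq]
  have := normSq_add_conj_sub_normSq_sub (exp v) c
  have hre : (exp v).re = 0 := by simp [exp_eq_mul_I hv]
  rw [hre] at this
  linarith

theorem hasDerivAt_stripToDisk {c v : ℂ} (hc : 0 < c.re) (hv : |v.im| ≤ Real.pi / 2) :
    HasDerivAt (stripToDisk c) (2 * c.re * exp v / (exp v + conj c) ^ 2) v := by
  have hcc : 2 * (c.re : ℂ) = c + conj c := by rw [add_conj]; push_cast; rfl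
  rw [hcc]
  convert! ((hasDerivAt_exp v).sub_const c).div ((hasDerivAt_exp v).add_const (conj c))
    (add_conj_ne_zero (re_exp_nonneg hv) hc) using 1
  ring

theorem abs_im_log_lt {w : ℂ} (hw : 0 < w.re) : |(log w).im| < Real.pi / 2 := by
  rw [log_im, abs_arg_lt_pi_div_two_iff]
  exact Or.inl hw

theorem stripToDisk_comp_isLittleO {α : ℝ} (hα : α ≠ 0) {c : ℂ} (hc : 0 < c.re) {N : ℕ}
    {q u : ℂ → ℂ} (hq : AnalyticAt ℂ q 0)
    (hk : ∀ k : ℕ, 1 ≤ k → k < N + 1 → iteratedDeriv k q 0 = 0)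
    (hu : ContinuousAt u 0) (hu0 : u 0 = log c) (hqu : ∀ᶠ z in 𝓝 0, exp (α * u z) = q z) :
    (fun z => stripToDisk c (u z)) =o[𝓝 0] fun z => ‖z‖ ^ N := by
  have hc0 : c ≠ 0 := fun h => by simp [h] at hc
  have hα' : (α : ℂ) ≠ 0 := by exact_mod_cast hα
  have htend : Tendsto u (𝓝 0) (𝓝 (log c)) := hu0 ▸ hu
  have h1 : (fun z => u z - log c) =O[𝓝 0] fun z => q z - q 0 := by
    have hd : HasDerivAt (fun v : ℂ => exp (α * v)) (exp (α * log c) * (α * 1)) (log c) :=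
      ((hasDerivAt_id (log c)).const_mul (α : ℂ)).cexp
    have hrev := (hd.isTheta_sub (by simp [hα'])).isBigO_symm
    refine (hrev.comp_tendsto (htend.prodMk tendsto_const_pure)).congr' (by rfl) ?_
    filter_upwards [hqu] with z hz
    simp [hz, ← hqu.self_of_nhds, hu0]
  have h2 : (fun z => stripToDisk c (u z)) =O[𝓝 0] fun z => u z - log c := by
    have := (hasDerivAt_stripToDisk hc (abs_im_log_lt hc).le).isBigO_sub.comp_tendsto htend
    simpa [Function.comp_def, stripToDisk, exp_log hc0] using this
  have h3 := isBigO_sub_pow_of_iteratedDeriv_eq_zero hq hk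
  have h4 : (fun z : ℂ => (z - 0) ^ (N + 1)) =o[𝓝 0] fun z => ‖z‖ ^ N := by
    simpa using (Asymptotics.isLittleO_pow_pow (𝕜 := ℂ) N.lt_succ_self).norm_right
  exact ((h2.trans h1).trans h3).trans_isLittleO h4

/-- The strip form of the subordination: `u` cannot leave the strip `|Im v| < π/2`. -/
theorem abs_im_lt_of_forall_stripR {α : ℝ} (hα : 0 < α) (hα1 : α ≤ 1) {c : ℂ} (hc : 0 < c.re)
    {N : ℕ} {u u' : ℂ → ℂ} (hu : ∀ z ∈ ball (0 : ℂ) 1, HasDerivAt u (u' z) z)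
    (hu0 : u 0 = log c)
    (hN : (fun z => stripToDisk c (u z)) =o[𝓝 0] fun z => ‖z‖ ^ N)
    (hsub : ∀ z ∈ ball (0 : ℂ) 1, ∃ v : ℂ, |v.im| < Real.pi / 2 ∧
      exp (α * u z) + α * (z * u' z) = stripR α c (N + 1) v) :
    ∀ z ∈ ball (0 : ℂ) 1, |(u z).im| < Real.pi / 2 := by
  by_contra! hcon
  obtain ⟨z₁, hz₁, hz₁im⟩ := hcon
  have hsubset : closedBall (0 : ℂ) ‖z₁‖ ⊆ ball 0 1 :=
    closedBall_subset_ball (mem_ball_zero_iff.1 hz₁)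
  have hcont : ContinuousOn (fun z => |(u z).im|) (ball 0 1) := fun z hz =>
    ((continuous_im.continuousAt.comp (hu z hz).continuousAt).abs).continuousWithinAt
  have hK : IsCompact (closedBall (0 : ℂ) ‖z₁‖ ∩ (fun z => |(u z).im|) ⁻¹' Ici (Real.pi / 2)) :=
    (isCompact_closedBall 0 ‖z₁‖).of_isClosed_subset
      ((hcont.mono hsubset).preimage_isClosed_of_isClosed isClosed_closedBall isClosed_Ici)
      inter_subset_left
  obtain ⟨z₀, ⟨hz₀K, hz₀im⟩, hmin⟩ := hK.exists_isMinOn ⟨z₁, by simp, hz₁im⟩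
    continuous_norm.continuousOn
  have hz₀ball : z₀ ∈ ball (0 : ℂ) 1 := hsubset hz₀K
  have hlt : ∀ z ∈ ball (0 : ℂ) ‖z₀‖, |(u z).im| < Real.pi / 2 := by
    intro z hz
    rw [mem_ball_zero_iff] at hz
    by_contra! hge
    exact hz.not_ge (hmin ⟨mem_closedBall_zero_iff.2
      (hz.le.trans (mem_closedBall_zero_iff.1 hz₀K)), hge⟩)
  have hz₀ : z₀ ≠ 0 := by
    rintro rfl
    exact (abs_im_log_lt hc).not_ge (hu0 ▸ hz₀im)
  have hle : ∀ z ∈ closedBall (0 : ℂ) ‖z₀‖, |(u z).im| ≤ Real.pi / 2 := by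
    have hsub₀ : closedBall (0 : ℂ) ‖z₀‖ ⊆ ball 0 1 :=
      closedBall_subset_ball (mem_ball_zero_iff.1 hz₀ball)
    rw [← closure_ball (0 : ℂ) (norm_ne_zero_iff.2 hz₀)] at hsub₀ ⊢
    exact fun z hz => le_on_closure (fun w hw => (hlt w hw).le) (hcont.mono hsub₀)
      continuousOn_const hz
  have heq : |(u z₀).im| = Real.pi / 2 := le_antisymm (hle z₀ (by simp)) hz₀im
  have hψd : ∀ z ∈ closedBall (0 : ℂ) ‖z₀‖, HasDerivAt (fun z => stripToDisk c (u z))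
      (2 * c.re * exp (u z) / (exp (u z) + conj c) ^ 2 * u' z) z := fun z hz =>
    (hasDerivAt_stripToDisk hc (hle z hz)).comp z (hu z
      (closedBall_subset_ball (mem_ball_zero_iff.1 hz₀ball) hz))
  obtain ⟨m, hm, hjack⟩ := exists_mul_deriv_eq_of_norm_eq_one hz₀
    (fun z hz => (hψd z (ball_subset_closedBall hz)).differentiableAt.differentiableWithinAt)
    (hψd z₀ (by simp)) (fun z hz => norm_stripToDisk_le_one hc (hle z hz))
    (by simp [hu0, stripToDisk, exp_log (show c ≠ 0 from fun h => by simp [h] at hc)]) hN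
    (norm_stripToDisk_eq_one hc heq)
  obtain ⟨v, hv, hveq⟩ := hsub z₀ hz₀ball
  refine stripR_ne_of_abs_im_eq hα hα1 hc (by positivity) hm heq hv (Eq.trans ?_ hveq)
  have hne := add_conj_ne_zero (re_exp_nonneg heq.le) hc
  have hc' : (c.re : ℂ) ≠ 0 := by exact_mod_cast hc.ne'
  have hzu : z₀ * u' z₀ = m * gcLogDeriv c (exp (u z₀)) := by
    have he := exp_ne_zero (u z₀)
    rw [stripToDisk] at hjack
    rw [gcLogDeriv]
    field_simp at hjack ⊢
    linear_combination hjack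
  rw [stripR, hzu]
  ring

/-- If `q ∈ H[c^α,n]` is nonvanishing on `𝔻` and `q + zq'/q ≺ R_{α,c,n}`,
then `q ≺ g_c^α`. -/
theorem generalized_open_door_subordination (c : ℂ) (hc : 0 < c.re)
    (α : ℝ) (hα : 0 < α) (hα1 : α ≤ 1) (n : ℕ) (hn : 0 < n)
    (q : ℂ → ℂ)
    (hqd : DifferentiableOn ℂ q (ball 0 1))
    (hq0 : q 0 = c ^ (α : ℂ))
    (hqk : ∀ k : ℕ, 1 ≤ k → k < n → iteratedDeriv k q 0 = 0)
    (hqne : ∀ z ∈ ball (0 : ℂ) 1, q z ≠ 0)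
    (hsub : Subordinate (fun z => q z + z * deriv q z / q z) (Rgen α c n)) :
    Subordinate q (fun z => gc c z ^ (α : ℂ)) := by
  obtain ⟨N, rfl⟩ := Nat.exists_eq_add_one_of_ne_zero hn.ne'
  have hc0 : c ≠ 0 := fun h => by simp [h] at hc
  have hα' : (α : ℂ) ≠ 0 := by exact_mod_cast hα.ne'
  have h0 : (0 : ℂ) ∈ ball (0 : ℂ) 1 := mem_ball_self one_pos
  obtain ⟨u, hu0, hu, hqu⟩ := exists_exp_mul_eq_of_ne_zero hqd hqne hα'
    (b := log c) (by rw [hq0, cpow_def_of_ne_zero hc0, mul_comm])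
  have hN := stripToDisk_comp_isLittleO hα.ne' hc (hqd.analyticAt (isOpen_ball.mem_nhds h0)) hqk
    (hu 0 h0).continuousAt hu0 (eventually_of_mem (isOpen_ball.mem_nhds h0) hqu)
  obtain ⟨ω₁, -, -, hω₁, hqω₁⟩ := hsub
  have him := abs_im_lt_of_forall_stripR hα hα1 hc hu hu0 hN fun z hz => by
    refine ⟨log (gc c (ω₁ z)), abs_im_log_lt (gc_re_pos hc (hω₁ z hz)), ?_⟩
    have h1 := Rgen_eq_stripR (α := α) hc (N + 1) (hω₁ z hz)
    rw [← hqω₁ z hz] at h1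
    push_cast at h1
    rw [← h1, hqu z hz]
    have := hqne z hz
    field_simp
  refine ⟨fun z => stripToDisk c (u z), fun z hz => ?_, ?_, fun z hz => ?_, fun z hz => ?_⟩
  · exact ((hasDerivAt_stripToDisk hc (him z hz).le).comp z
      (hu z hz)).differentiableAt.differentiableWithinAt
  · simp [stripToDisk, hu0, exp_log hc0]
  · exact mem_ball_zero_iff.2 (norm_stripToDisk_lt_one hc (him z hz))
  · have hπ := abs_lt.1 (him z hz)
    simp only [stripToDisk]
    rw [gc_div_add_conj hc (re_exp_pos (him z hz)), cpow_def_of_ne_zero (exp_ne_zero _),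
      log_exp (by linarith [Real.pi_pos]) (by linarith [Real.pi_pos]), mul_comm, hqu z hz]
end

section
/- Let 0 < α < 1, let c = r e^{it} with r > 0 and −π/2 < t < π/2, and let n be a positive integer. Define ξ_± = (∓α sin t + √(1 − α² cos² t))/(1 − α) and Θ_± = arctan[ tan(πα/2) + n(ξ_± − ξ_±^{−1}) / (2 r^α ξ_±^α cos(πα/2) cos t) ]. If a function q ∈ H[c^α, n] satisfies, for all z ∈ 𝔻, q(z) ≠ 0, q(z) + z·q′(z)/q(z) ≠ 0, and −Θ_− < arg(q(z) + z·q′(z)/q(z)) < Θ_+, then |arg q(z)| < πα/2 for all z ∈ 𝔻. -/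
open Complex Metric Set Real
open scoped Topology ComplexConjugate
/-- The **lemma of Jack**, for the first boundary point where a function of order `n` at `0` reaches
modulus one. -/
theorem jack_lemma {f : ℂ → ℂ} {n : ℕ} {z₀ f' : ℂ} (hn : 0 < n) (hz₀ : z₀ ≠ 0)
    (hd : DifferentiableOn ℂ f (ball 0 ‖z₀‖)) (hd₀ : HasDerivAt f f' z₀) (hf0 : f 0 = 0)
    (hO : f =O[𝓝 0] (fun z ↦ z ^ n)) (hle : ∀ z ∈ closedBall 0 ‖z₀‖, ‖f z‖ ≤ 1)
    (h1 : ‖f z₀‖ = 1) : ∃ m : ℝ, n ≤ m ∧ z₀ * f' = m * f z₀ := by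
  obtain ⟨N, rfl⟩ : ∃ N, n = N + 1 := ⟨n - 1, by omega⟩
  have hpos : 0 < ‖z₀‖ := norm_pos_iff.2 hz₀
  have hsch : ∀ z ∈ ball 0 ‖z₀‖, ‖f z‖ ≤ (‖z‖ / ‖z₀‖) ^ (N + 1) := by
    intro z hz
    have := dist_le_mul_div_pow_of_mapsTo_ball_of_isLittleO (f := f) (c := 0) (R₁ := ‖z₀‖)
      (R₂ := 1) (n := N) hd (fun w hw ↦ by simpa [hf0] using hle w (ball_subset_closedBall hw)) ?_ hz
    · simpa [hf0] using this
    · simp only [hf0, sub_zero]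
      refine hO.trans_isLittleO ?_
      simp only [← norm_pow]
      exact (Asymptotics.isLittleO_pow_pow N.lt_succ_self).norm_right
  have hff : conj (f z₀) * f z₀ = 1 := by
    rw [← Complex.normSq_eq_conj_mul_self, Complex.normSq_eq_norm_sq, h1]; simp
  set D := conj (f z₀) * (z₀ * f') with hD
  have hDf : z₀ * f' = D * f z₀ := by
    rw [hD]; linear_combination -(z₀ * f') * hff
  have hbound : ∀ z, (conj (f z₀) * f z).re ≤ ‖f z‖ := fun z ↦ by
    refine (Complex.re_le_norm _).trans ?_
    simp [h1]
  have hradial : HasDerivAt (fun s : ℝ ↦ (conj (f z₀) * f (s * z₀)).re) D.re 1 := by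
    have h2 : HasDerivAt (fun s : ℂ ↦ conj (f z₀) * f (s * z₀)) D ((1 : ℝ) : ℂ) := by
      have h3 : HasDerivAt (fun s : ℂ ↦ s * z₀) z₀ 1 := by
        simpa using (hasDerivAt_id (1 : ℂ)).mul_const z₀
      have h4 : HasDerivAt f f' (1 * z₀) := by simpa using hd₀
      have := (h4.comp (1 : ℂ) h3).const_mul (conj (f z₀))
      convert! this using 1
      rw [hD]; ring
    exact h2.real_of_complex
  have hang : HasDerivAt (fun θ : ℝ ↦ (conj (f z₀) * f (Complex.exp (θ * I) * z₀)).re)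
      (I * D).re 0 := by
    have h2 : HasDerivAt (fun s : ℂ ↦ conj (f z₀) * f (Complex.exp (s * I) * z₀)) (I * D)
        ((0 : ℝ) : ℂ) := by
      have h3 : HasDerivAt (fun s : ℂ ↦ Complex.exp (s * I) * z₀) (I * z₀) 0 := by
        simpa using ((hasDerivAt_id (0 : ℂ)).mul_const I).cexp.mul_const z₀
      have h4 : HasDerivAt f f' (Complex.exp (0 * I) * z₀) := by simpa using hd₀
      have := (h4.comp (0 : ℂ) h3).const_mul (conj (f z₀))
      convert! this using 1
      rw [hD]; ring
    exact h2.real_of_complex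
  have him : (I * D).re = 0 := by
    refine IsLocalMax.hasDerivAt_eq_zero (Filter.Eventually.of_forall fun θ ↦ ?_) hang
    have h5 := (hbound (Complex.exp (θ * I) * z₀)).trans (hle _ (by simp))
    simpa [hff] using h5
  have hre : ((N + 1 : ℕ) : ℝ) ≤ D.re := by
    have h6 : HasDerivAt (fun s : ℝ ↦ s ^ (N + 1) - (conj (f z₀) * f (s * z₀)).re)
        ((N + 1 : ℕ) - D.re) 1 := by
      convert! (hasDerivAt_pow (N + 1) (1 : ℝ)).sub hradial using 1
      simp
    have h7 : ∀ᶠ s in 𝓝[<] (1 : ℝ), 0 ≤ (s : ℝ) ^ (N + 1) - (conj (f z₀) * f (s * z₀)).re := by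
      filter_upwards [Ioo_mem_nhdsLT (zero_lt_one' ℝ)] with s hs
      have h8 := (hbound (s * z₀)).trans (hsch _ (by
        simp only [mem_ball_zero_iff, norm_mul, Complex.norm_real, Real.norm_of_nonneg hs.1.le]
        nlinarith [hs.2]))
      simp only [norm_mul, Complex.norm_real, Real.norm_of_nonneg hs.1.le] at h8
      rw [mul_div_cancel_right₀ _ hpos.ne'] at h8
      linarith
    have h9 := (hasDerivWithinAt_iff_tendsto_slope' (s := Iio (1 : ℝ)) (by simp)).1
      h6.hasDerivWithinAt
    refine sub_nonpos.1 (le_of_tendsto h9 ?_)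
    filter_upwards [h7, self_mem_nhdsWithin] with s hs hs1
    rw [slope_def_field]
    refine div_nonpos_of_nonneg_of_nonpos ?_ (sub_nonpos.2 (le_of_lt hs1))
    simpa only [Complex.ofReal_one, one_mul, hff, Complex.one_re, one_pow, sub_self, sub_zero]
      using hs
  refine ⟨D.re, hre, ?_⟩
  rw [hDf]
  congr 1
  exact Complex.ext rfl (by simpa using him)

/-- The positive root `ξ` of `(1 - α) ξ² + 2 α s ξ = 1 + α` minimises
`x ↦ α (1 - 2 s x + x²) / x ^ (1 + α)` on the positive reals. -/
theorem sub_inv_div_rpow_le {α ξ s x : ℝ} (hα0 : 0 < α) (hα1 : α < 1) (hξ : 0 < ξ) (hx : 0 < x)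
    (hroot : (1 - α) * ξ ^ 2 + 2 * α * s * ξ - (1 + α) = 0) :
    (ξ - ξ⁻¹) / ξ ^ α ≤ α * (1 - 2 * s * x + x ^ 2) / (x * x ^ α) := by
  obtain ⟨u, hu, rfl⟩ : ∃ u, 0 < u ∧ x = ξ * u := ⟨x / ξ, by positivity, by field_simp⟩
  have h1 : u ^ α ≤ 1 - α + α * u := by
    have := rpow_one_add_le_one_add_mul_self (s := u - 1) (by linarith) hα0.le hα1.le
    rw [show 1 + (u - 1) = u by ring] at this
    linarith
  have h2 : (1 + α) * u - α ≤ u * u ^ α := by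
    have := one_add_mul_self_le_rpow_one_add (s := u - 1) (by linarith)
      (p := 1 + α) (by linarith)
    rw [show 1 + (u - 1) = u by ring, Real.rpow_add hu, Real.rpow_one] at this
    linarith
  have hU : 0 < u ^ α := by positivity
  have hX : 0 < ξ ^ α := by positivity
  rw [Real.mul_rpow hξ.le hu.le, div_le_div_iff₀ hX (by positivity)]
  have hs : 2 * α * s * ξ = 1 + α - (1 - α) * ξ ^ 2 := by linarith
  generalize u ^ α = U at *
  generalize ξ ^ α = X at *
  have : (ξ - ξ⁻¹) * (ξ * u * (X * U)) = (ξ ^ 2 - 1) * u * U * X := by field_simp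
  rw [this]
  refine mul_le_mul_of_nonneg_right ?_ hX.le
  have : α * (1 - 2 * s * (ξ * u) + (ξ * u) ^ 2) =
      α - u * (1 + α - (1 - α) * ξ ^ 2) + α * ξ ^ 2 * u ^ 2 := by
    rw [← hs]; ring
  rw [this]
  nlinarith [mul_nonneg (mul_nonneg (sq_nonneg ξ) hu.le) (sub_nonneg.2 h1)]

/-- The Miller–Mocanu boundary lemma for functions with nonnegative real part: at a boundary point
`z₀` where `Re p` vanishes, the product of `z₀` and the derivative is real and negative with an explicit bound. -/
theorem exists_mul_deriv_eq_neg_of_re_eq_zero {p : ℂ → ℂ} {n : ℕ} {z₀ p' c : ℂ} (hn : 0 < n)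
    (hz₀ : z₀ ≠ 0) (hc : 0 < c.re) (hd : DifferentiableOn ℂ p (ball 0 ‖z₀‖)) (hd₀ : HasDerivAt p p' z₀)
    (hp0 : p 0 = c) (hO : (fun z ↦ p z - c) =O[𝓝 0] (fun z ↦ z ^ n))
    (hre : ∀ z ∈ closedBall 0 ‖z₀‖, 0 ≤ (p z).re) (h0 : (p z₀).re = 0) :
    ∃ k : ℝ, n * ‖p z₀ - c‖ ^ 2 / (2 * c.re) ≤ k ∧ z₀ * p' = -k := by
  have hpos : 0 < ‖z₀‖ := norm_pos_iff.2 hz₀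
  have hne : ∀ z ∈ closedBall 0 ‖z₀‖, p z + conj c ≠ 0 := fun z hz h ↦ by
    have := congrArg Complex.re h
    simp only [Complex.add_re, Complex.conj_re, Complex.zero_re] at this
    linarith [hre z hz]
  have hz₀m : z₀ ∈ closedBall 0 ‖z₀‖ := by simp
  have hmul : (p z₀ - c) * (p z₀ + conj c) = -(‖p z₀ - c‖ ^ 2 : ℝ) := by
    rw [← Complex.normSq_eq_norm_sq]
    apply Complex.ext <;>
      simp only [Complex.mul_re, Complex.mul_im, Complex.sub_re, Complex.sub_im, Complex.add_re,
        Complex.add_im, Complex.conj_re, Complex.conj_im, Complex.neg_re, Complex.neg_im,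
        Complex.ofReal_re, Complex.ofReal_im, Complex.normSq_apply, h0] <;> ring
  have hnorm : ‖p z₀ + conj c‖ = ‖p z₀ - c‖ := by
    rw [Complex.norm_eq_sqrt_sq_add_sq, Complex.norm_eq_sqrt_sq_add_sq]
    congr 1
    simp only [Complex.sub_re, Complex.sub_im, Complex.add_re, Complex.add_im, Complex.conj_re,
      Complex.conj_im, h0]
    ring
  obtain ⟨m, hm, hmf⟩ := jack_lemma (f := fun z ↦ (p z - c) / (p z + conj c)) hn hz₀
    (fun z hz ↦ ((hd z hz).sub_const _).div ((hd z hz).add_const _)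
      (hne z (ball_subset_closedBall hz)))
    ((hd₀.sub_const c).div (hd₀.add_const (conj c)) (hne z₀ hz₀m)) (by simp [hp0])
    (by
      have hcont : ContinuousAt p 0 := (hd.continuousOn).continuousAt (ball_mem_nhds _ hpos)
      have hb : (fun z ↦ (p z + conj c)⁻¹) =O[𝓝 0] (fun _ ↦ (1 : ℂ)) :=
        ((hcont.add continuousAt_const).inv₀ (hne 0 (by simp))).isBigO_one ℂ
      simpa [div_eq_mul_inv] using hO.mul hb)
    (fun z hz ↦ by
      rw [norm_div]
      refine div_le_one_of_le₀ ?_ (norm_nonneg _)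
      refine (sq_le_sq₀ (norm_nonneg _) (norm_nonneg _)).1 ?_
      rw [← Complex.normSq_eq_norm_sq, ← Complex.normSq_eq_norm_sq]
      simp only [Complex.normSq_apply, Complex.sub_re, Complex.sub_im, Complex.add_re,
        Complex.add_im, Complex.conj_re, Complex.conj_im]
      nlinarith [mul_nonneg (hre z hz) hc.le])
    (by rw [norm_div, ← hnorm, div_self (norm_ne_zero_iff.2 (hne z₀ hz₀m))])
  refine ⟨m * ‖p z₀ - c‖ ^ 2 / (2 * c.re), by gcongr, ?_⟩
  have hcc : c + conj c = (2 * c.re : ℝ) := Complex.add_conj c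
  have h2 : z₀ * p' * (2 * c.re : ℝ) = m * ((p z₀ - c) * (p z₀ + conj c)) := by
    have := hne z₀ hz₀m
    rw [← hcc]
    field_simp at hmf
    linear_combination hmf
  rw [hmul] at h2
  have h3 : ((2 * c.re : ℝ) : ℂ) ≠ 0 := by exact_mod_cast (by positivity : (2 * c.re) ≠ 0)
  rw [Complex.ofReal_div, ← neg_div, eq_div_iff h3, h2]
  push_cast; ring

/-- A continuous function on the disk which starts below `A` and reaches `A` does so at a point
of minimal modulus. -/
theorem exists_minimal_norm_eq {u : ℂ → ℝ} {A : ℝ} (hu : ContinuousOn u (ball 0 1)) (h0 : u 0 < A)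
    {z₁ : ℂ} (hz₁ : z₁ ∈ ball (0 : ℂ) 1) (hA : A ≤ u z₁) :
    ∃ z₀ ∈ ball (0 : ℂ) 1, z₀ ≠ 0 ∧ u z₀ = A ∧ ∀ z ∈ closedBall 0 ‖z₀‖, u z ≤ A := by
  have hsub : ∀ {z : ℂ}, z ∈ ball (0 : ℂ) 1 → closedBall (0 : ℂ) ‖z‖ ⊆ ball 0 1 := fun hz ↦
    closedBall_subset_ball (by simpa using hz)
  have hK : IsCompact (closedBall (0 : ℂ) ‖z₁‖ ∩ u ⁻¹' Ici A) :=
    (isCompact_closedBall _ _).of_isClosed_subset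
      ((hu.mono (hsub hz₁)).preimage_isClosed_of_isClosed isClosed_closedBall isClosed_Ici)
      inter_subset_left
  obtain ⟨z₀, ⟨hz₀, hAz₀⟩, hmin⟩ := hK.exists_isMinOn ⟨z₁, by simp, hA⟩ continuous_norm.continuousOn
  have hz₀b := hsub hz₁ hz₀
  have hne : z₀ ≠ 0 := by
    rintro rfl
    exact absurd h0 (not_lt.2 hAz₀)
  have hin : MapsTo u (ball 0 ‖z₀‖) (Iic A) := fun z hz ↦ by
    by_contra hlt
    have hz' : ‖z‖ < ‖z₀‖ := by simpa using hz
    have : ‖z₀‖ ≤ ‖z‖ := hmin ⟨by simpa using hz'.le.trans (by simpa using hz₀),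
      (not_le.1 (show ¬ u z ≤ A from hlt)).le⟩
    exact absurd hz' (not_lt.2 this)
  have hcl := closure_ball (0 : ℂ) (norm_ne_zero_iff.2 hne)
  have hle := hin.closure_of_continuousOn (by rw [hcl]; exact hu.mono (hsub hz₀b))
  rw [hcl, isClosed_Iic.closure_eq] at hle
  exact ⟨z₀, hz₀b, hne, le_antisymm (hle (by simp)) hAz₀, hle⟩

/-- A zero-free holomorphic function on the disk has a holomorphic logarithm with prescribed
value at `0`. -/
theorem exists_hasDerivAt_log {q : ℂ → ℂ} (hq : DifferentiableOn ℂ q (ball 0 1))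
    (hne : ∀ z ∈ ball (0 : ℂ) 1, q z ≠ 0) {a : ℂ} (ha : q 0 = Complex.exp a) :
    ∃ h : ℂ → ℂ, h 0 = a ∧ ∀ z ∈ ball (0 : ℂ) 1,
      Complex.exp (h z) = q z ∧ HasDerivAt h (deriv q z / q z) z := by
  obtain ⟨h, h0, hh⟩ := (((hq.deriv isOpen_ball).div hq hne).isExactOn_ball).with_val_at 0 a
  have hq' : ∀ z ∈ ball (0 : ℂ) 1, HasDerivAt q (deriv q z) z := fun z hz ↦
    (hq.differentiableAt (isOpen_ball.mem_nhds hz)).hasDerivAt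
  have hF : ∀ z ∈ ball (0 : ℂ) 1, HasDerivAt (fun z ↦ q z * Complex.exp (-h z)) 0 z := fun z hz ↦ by
    convert! (hq' z hz).mul (hh z hz).neg.cexp using 1
    have := hne z hz
    simp only [Pi.neg_apply, Pi.div_apply]
    field_simp
    ring
  refine ⟨h, h0, fun z hz ↦ ⟨?_, hh z hz⟩⟩
  have hconst := (convex_ball (0 : ℂ) 1).is_const_of_fderivWithin_eq_zero (𝕜 := ℂ)
    (fun w hw ↦ (hF w hw).differentiableAt.differentiableWithinAt)
    (fun w hw ↦ by
      rw [fderivWithin_of_isOpen isOpen_ball hw]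
      exact ContinuousLinearMap.ext_ring (by simpa using (hF w hw).deriv))
    hz (mem_ball_self one_pos)
  simp only [h0, ha, ← Complex.exp_add, add_neg_cancel, Complex.exp_zero] at hconst
  rw [Complex.exp_neg] at hconst
  exact (mul_inv_eq_one₀ (Complex.exp_ne_zero _)).1 hconst |>.symm

theorem sub_isBigO_pow_of_iteratedDeriv_eq_zero {q : ℂ → ℂ} {n : ℕ} (hq : AnalyticAt ℂ q 0)
    (hqk : ∀ k : ℕ, 1 ≤ k → k < n → iteratedDeriv k q 0 = 0) (hn : 0 < n) :
    (fun z ↦ q z - q 0) =O[𝓝 0] (fun z ↦ z ^ n) := by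
  obtain ⟨F, hF, h⟩ := hq.exists_eq_sum_add_pow_mul n
  have h' : (fun z ↦ q z - q 0) = fun z ↦ z ^ n * F z := by
    funext z
    rw [h z, Finset.sum_eq_single_of_mem 0 (by simpa using hn) fun k hk hk0 ↦ by
      rw [hqk k (Nat.one_le_iff_ne_zero.2 hk0) (Finset.mem_range.1 hk), smul_zero]]
    simp
  rw [h']
  simpa using (Asymptotics.isBigO_refl (fun z : ℂ ↦ z ^ n) _).mul (hF.continuousAt.isBigO_one ℂ)

theorem exp_div_sub_isBigO_pow {h : ℂ → ℂ} {a α : ℂ} {n : ℕ} (hh : ContinuousAt h 0)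
    (h0 : h 0 = a)
    (hO : (fun z ↦ Complex.exp (h z) - Complex.exp a) =O[𝓝 0] (fun z ↦ z ^ n)) :
    (fun z ↦ Complex.exp (h z / α) - Complex.exp (a / α)) =O[𝓝 0] (fun z ↦ z ^ n) := by
  subst h0
  have h1 : (fun w ↦ w - h 0) =O[𝓝 (h 0)] fun w ↦ Complex.exp w - Complex.exp (h 0) :=
    (HasDerivAtFilter.isTheta_sub (Complex.hasDerivAt_exp (h 0)) (Complex.exp_ne_zero _)).2
      |>.comp_tendsto (k := fun w ↦ (w, h 0))
        (Filter.tendsto_id.prodMk (Filter.tendsto_pure.2 (Filter.Eventually.of_forall fun _ ↦ rfl)))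
  have h2 : (fun w ↦ Complex.exp (w / α) - Complex.exp (h 0 / α)) =O[𝓝 (h 0)] fun w ↦ w - h 0 :=
    ((hasDerivAt_id (h 0)).div_const α).cexp.isBigO_sub
  exact ((h2.trans h1).comp_tendsto hh).trans hO

theorem pos_and_quadratic_eq_zero {α s S ξ : ℝ} (hα0 : 0 < α) (hα1 : α < 1)
    (hS : S = α ^ 2 * s ^ 2 + (1 - α ^ 2))
    (hξ : ξ = (-(α * s) + √S) / (1 - α)) :
    0 < ξ ∧ (1 - α) * ξ ^ 2 + 2 * α * s * ξ - (1 + α) = 0 := by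
  have h1 : 0 < 1 - α := by linarith
  have hlt : (α * s) ^ 2 < S := by nlinarith
  have hroot : (1 - α) * ξ + α * s = √S := by rw [hξ]; field_simp; ring
  refine ⟨hξ ▸ div_pos ?_ h1, ?_⟩
  · linarith [(abs_le.1 (Real.abs_le_sqrt hlt.le)).2, Real.lt_sqrt_of_sq_lt hlt]
  · have h2 := Real.sq_sqrt ((sq_nonneg _).trans hlt.le)
    rw [← hroot, hS] at h2
    refine (mul_right_inj' h1.ne').1 ?_
    linear_combination h2

theorem div_rpow_le_of_quadratic_eq_zero {α r ct s ξ y k C : ℝ} {n : ℕ} (hα0 : 0 < α)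
    (hα1 : α < 1) (hr : 0 < r) (hct : 0 < ct) (hC : 0 < C) (hξ : 0 < ξ) (hy : 0 < y)
    (hroot : (1 - α) * ξ ^ 2 + 2 * α * s * ξ - (1 + α) = 0)
    (hk : n * (r ^ 2 - 2 * r * s * y + y ^ 2) / (2 * (r * ct)) ≤ k) :
    n * (ξ - ξ⁻¹) / (2 * r ^ α * ξ ^ α * C * ct) ≤ α * k / (y * (y ^ α * C)) := by
  obtain ⟨x, hx, rfl⟩ : ∃ x, 0 < x ∧ y = r * x := ⟨y / r, by positivity, by field_simp⟩
  have hb := sub_inv_div_rpow_le (s := s) hα0 hα1 hξ hx hroot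
  have hR : 0 < r ^ α := by positivity
  rw [Real.mul_rpow hr.le hx.le]
  calc _ = n / (2 * r ^ α * C * ct) * ((ξ - ξ⁻¹) / ξ ^ α) := by field_simp
    _ ≤ n / (2 * r ^ α * C * ct) * (α * (1 - 2 * s * x + x ^ 2) / (x * x ^ α)) := by gcongr
    _ = α * (n * (r ^ 2 - 2 * r * s * (r * x) + (r * x) ^ 2) / (2 * (r * ct))) /
        (r * x * (r ^ α * x ^ α * C)) := by field_simp
    _ ≤ _ := by gcongr

theorem arg_eq_arctan_of_re_pos {w : ℂ} (hw : 0 < w.re) : w.arg = Real.arctan (w.im / w.re) := by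
  have h := abs_lt.1 (Complex.abs_arg_lt_pi_div_two_iff.2 (Or.inl hw))
  rw [← Complex.tan_arg, Real.arctan_tan h.1 h.2]

/-- If `exp h` first leaves the sector `|arg| < π α / 2` at `z₀`, on the side given by the sign `σ`,
then `exp h + z h'` lies outside the corresponding side of the open door sector at `z₀`. -/
theorem arctan_le_mul_arg_of_boundary {α r t σ : ℝ} (hα0 : 0 < α) (hα1 : α < 1)
    (hr : 0 < r) (ht1 : -(π / 2) < t) (ht2 : t < π / 2) {n : ℕ} (hn : 0 < n)
    (hσ : σ = 1 ∨ σ = -1) {ξ : ℝ}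
    (hξ : ξ = (-(α * (σ * Real.sin t)) + √(1 - α ^ 2 * Real.cos t ^ 2)) / (1 - α))
    {h : ℂ → ℂ} {z₀ h' : ℂ} (hz₀ : z₀ ≠ 0) (hd : DifferentiableOn ℂ h (ball 0 ‖z₀‖))
    (hd₀ : HasDerivAt h h' z₀) (h0 : h 0 = α * (Real.log r + t * I))
    (hO : (fun z ↦ Complex.exp (h z) - Complex.exp (α * (Real.log r + t * I)))
      =O[𝓝 0] (fun z ↦ z ^ n))
    (hle : ∀ z ∈ closedBall 0 ‖z₀‖, |(h z).im| ≤ π * α / 2)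
    (him : (h z₀).im = σ * (π * α / 2)) :
    Real.arctan (Real.tan (π * α / 2) +
      n * (ξ - ξ⁻¹) / (2 * r ^ α * ξ ^ α * Real.cos (π * α / 2) * Real.cos t)) ≤
      σ * (Complex.exp (h z₀) + z₀ * h').arg := by
  have hct : 0 < Real.cos t := Real.cos_pos_of_mem_Ioo ⟨ht1, ht2⟩
  have hC : 0 < Real.cos (π * α / 2) :=
    Real.cos_pos_of_mem_Ioo ⟨by nlinarith [Real.pi_pos], by nlinarith [Real.pi_pos]⟩
  have hσ2 : σ ^ 2 = 1 := by rcases hσ with rfl | rfl <;> norm_num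
  obtain ⟨hξ0, hroot⟩ := pos_and_quadratic_eq_zero (s := σ * Real.sin t) hα0 hα1
    (by rw [mul_pow, hσ2, Real.sin_sq]; ring) hξ
  have hαC : (α : ℂ) ≠ 0 := by exact_mod_cast hα0.ne'
  have hpos : 0 < ‖z₀‖ := norm_pos_iff.2 hz₀
  set c := Complex.exp (Real.log r + t * I) with hc
  have hcre : c.re = r * Real.cos t := by
    simp [hc, Complex.exp_re, Real.exp_log hr]
  have hcim : c.im = r * Real.sin t := by
    simp [hc, Complex.exp_im, Real.exp_log hr]
  have hp0 : Complex.exp (h 0 / α) = c := by rw [h0, mul_div_cancel_left₀ _ hαC]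
  set y := Real.exp ((h z₀).re / α) with hy
  have hy0 : 0 < y := Real.exp_pos _
  have hpim : (h z₀ / α).im = σ * (π / 2) := by
    rw [Complex.div_ofReal_im, him]; field_simp
  have hpz : Complex.exp (h z₀ / α) = σ * y * I := by
    apply Complex.ext
    · rw [Complex.exp_re, hpim]
      rcases hσ with rfl | rfl <;> simp
    · rw [Complex.exp_im, hpim, Complex.div_ofReal_re]
      rcases hσ with rfl | rfl <;> simp [hy, Real.exp]
  have hbO := exp_div_sub_isBigO_pow (α := α)
    (hd.continuousOn.continuousAt (ball_mem_nhds _ hpos)) h0 hO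
  rw [mul_div_cancel_left₀ _ hαC] at hbO
  obtain ⟨k, hk, hkz⟩ := exists_mul_deriv_eq_neg_of_re_eq_zero
    (p := fun z ↦ Complex.exp (h z / α)) hn hz₀
    (by rw [hcre]; positivity) ((hd.div_const _).cexp) (hd₀.div_const _).cexp hp0 hbO
    (fun z hz ↦ by
      rw [Complex.exp_re, Complex.div_ofReal_im]
      refine mul_nonneg (Real.exp_pos _).le (Real.cos_nonneg_of_mem_Icc ?_)
      rw [mem_Icc, ← abs_le, abs_div, abs_of_pos hα0, div_le_iff₀ hα0]
      linarith [hle z hz])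
    (by simp [hpz])
  have hzh : z₀ * h' = (σ * (α * k / y) : ℝ) * I := by
    rw [hpz] at hkz
    have hyC : (y : ℂ) ≠ 0 := by exact_mod_cast hy0.ne'
    have hσC : (σ : ℂ) ^ 2 = 1 := by exact_mod_cast hσ2
    push_cast
    field_simp at hkz ⊢
    linear_combination (-σ * I) * hkz + z₀ * h' * y * I ^ 2 * hσC + z₀ * h' * y * Complex.I_sq
  have hnorm : ‖Complex.exp (h z₀ / α) - c‖ ^ 2 =
      r ^ 2 - 2 * r * (σ * Real.sin t) * y + y ^ 2 := by
    rw [hpz, ← Complex.normSq_eq_norm_sq, Complex.normSq_apply]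
    simp only [Complex.sub_re, Complex.sub_im, hcre, hcim, Complex.mul_re, Complex.mul_im,
      Complex.ofReal_re, Complex.ofReal_im, Complex.I_re, Complex.I_im]
    linear_combination r ^ 2 * Real.sin_sq_add_cos_sq t + y ^ 2 * hσ2
  rw [hnorm, hcre] at hk
  have hT := div_rpow_le_of_quadratic_eq_zero hα0 hα1 hr hct hC hξ0 hy0 hroot hk
  have hyα : Real.exp (h z₀).re = y ^ α := by
    rw [hy, ← Real.exp_mul, div_mul_cancel₀ _ hα0.ne']
  have hyα0 : 0 < y ^ α := by positivity
  have hwre : (Complex.exp (h z₀) + z₀ * h').re = y ^ α * Real.cos (π * α / 2) := by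
    rw [hzh, Complex.add_re, Complex.exp_re, hyα, him]
    rcases hσ with rfl | rfl <;> simp
  have hwim : (Complex.exp (h z₀) + z₀ * h').im =
      σ * (y ^ α * Real.sin (π * α / 2) + α * k / y) := by
    rw [hzh, Complex.add_im, Complex.exp_im, hyα, him]
    rcases hσ with rfl | rfl <;> simp
    ring
  have harg : σ * (Complex.exp (h z₀) + z₀ * h').arg = Real.arctan
      ((y ^ α * Real.sin (π * α / 2) + α * k / y) / (y ^ α * Real.cos (π * α / 2))) := by
    rw [arg_eq_arctan_of_re_pos (by rw [hwre]; positivity), hwre, hwim]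
    rcases hσ with rfl | rfl
    · simp
    · rw [mul_div_assoc, neg_one_mul, neg_one_mul, Real.arctan_neg, neg_neg]
  rw [harg]
  refine Real.arctan_strictMono.monotone ?_
  calc _ ≤ Real.tan (π * α / 2) + α * k / (y * (y ^ α * Real.cos (π * α / 2))) := by gcongr
    _ = _ := by rw [Real.tan_eq_sin_div_cos]; field_simp

/-- Corollary: a sector condition on `q + zq'/q` implies `|arg q| < πα/2`. -/
theorem sector_open_door (α r t : ℝ) (hα0 : 0 < α) (hα1 : α < 1)
    (hr : 0 < r) (ht1 : -(π / 2) < t) (ht2 : t < π / 2)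
    (n : ℕ) (hn : 0 < n)
    (c : ℂ) (hc : c = (r : ℂ) * Complex.exp ((t : ℂ) * Complex.I))
    (ξp ξm Θp Θm : ℝ)
    (hξp : ξp = (-(α * Real.sin t) + Real.sqrt (1 - α ^ 2 * Real.cos t ^ 2)) / (1 - α))
    (hξm : ξm = (α * Real.sin t + Real.sqrt (1 - α ^ 2 * Real.cos t ^ 2)) / (1 - α))
    (hΘp : Θp = Real.arctan (Real.tan (π * α / 2) +
      n * (ξp - ξp⁻¹) / (2 * r ^ α * ξp ^ α * Real.cos (π * α / 2) * Real.cos t)))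
    (hΘm : Θm = Real.arctan (Real.tan (π * α / 2) +
      n * (ξm - ξm⁻¹) / (2 * r ^ α * ξm ^ α * Real.cos (π * α / 2) * Real.cos t)))
    (q : ℂ → ℂ)
    (hqd : DifferentiableOn ℂ q (ball 0 1))
    (hq0 : q 0 = c ^ (α : ℂ))
    (hqk : ∀ k : ℕ, 1 ≤ k → k < n → iteratedDeriv k q 0 = 0)
    (hqne : ∀ z ∈ ball (0 : ℂ) 1, q z ≠ 0)
    (hne : ∀ z ∈ ball (0 : ℂ) 1, q z + z * deriv q z / q z ≠ 0)
    (harg : ∀ z ∈ ball (0 : ℂ) 1,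
      -Θm < (q z + z * deriv q z / q z).arg ∧ (q z + z * deriv q z / q z).arg < Θp) :
    ∀ z ∈ ball (0 : ℂ) 1, |(q z).arg| < π * α / 2 := by
  have hπ := Real.pi_pos
  have hcexp : c = Complex.exp (Real.log r + t * I) := by
    rw [hc, Complex.exp_add, ← Complex.ofReal_exp, Real.exp_log hr]
  have ha : q 0 = Complex.exp (α * (Real.log r + t * I)) := by
    rw [hq0, hcexp, Complex.cpow_def_of_ne_zero (Complex.exp_ne_zero _), Complex.log_exp, mul_comm]
      <;> simp <;> linarith
  obtain ⟨h, h0, hh⟩ := exists_hasDerivAt_log hqd hqne ha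
  have hhd : DifferentiableOn ℂ h (ball 0 1) := fun z hz ↦
    (hh z hz).2.differentiableAt.differentiableWithinAt
  have hO : (fun z ↦ Complex.exp (h z) - Complex.exp (α * (Real.log r + t * I)))
      =O[𝓝 0] (fun z ↦ z ^ n) := by
    refine (sub_isBigO_pow_of_iteratedDeriv_eq_zero (hqd.analyticAt (ball_mem_nhds 0 one_pos))
      hqk hn).congr' ?_ .rfl
    filter_upwards [ball_mem_nhds (0 : ℂ) one_pos] with z hz
    rw [(hh z hz).1, ha]
  have key : ∀ z ∈ ball (0 : ℂ) 1, |(h z).im| < π * α / 2 := by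
    by_contra! hcon
    obtain ⟨z₁, hz₁, hA⟩ := hcon
    obtain ⟨z₀, hz₀, hne0, hu, hle⟩ := exists_minimal_norm_eq (u := fun z ↦ |(h z).im|)
      (Complex.continuous_im.comp_continuousOn hhd.continuousOn).abs
      (by
        have : |t| < π / 2 := abs_lt.2 ⟨ht1, ht2⟩
        simp [h0, abs_mul, abs_of_pos hα0]
        nlinarith) hz₁ hA
    have hsub : ball (0 : ℂ) ‖z₀‖ ⊆ ball 0 1 := ball_subset_ball (mem_ball_zero_iff.1 hz₀).le
    have hw := harg z₀ hz₀
    rw [mul_div_assoc] at hw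
    rcases (abs_eq (by positivity)).1 hu with him | him
    · have := arctan_le_mul_arg_of_boundary (σ := 1) hα0 hα1 hr ht1 ht2 hn
        (Or.inl rfl) (by simpa using hξp) hne0
        (hhd.mono hsub) (hh z₀ hz₀).2 h0 hO hle (by simpa using him)
      rw [← hΘp, (hh z₀ hz₀).1] at this
      linarith
    · have := arctan_le_mul_arg_of_boundary (σ := -1) hα0 hα1 hr ht1 ht2 hn
        (Or.inr rfl) (by simpa using hξm) hne0
        (hhd.mono hsub) (hh z₀ hz₀).2 h0 hO hle (by simpa using him)
      rw [← hΘm, (hh z₀ hz₀).1] at this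
      linarith
  intro z hz
  have hk := key z hz
  obtain ⟨h1, h2⟩ := abs_lt.1 hk
  rwa [← (hh z hz).1, ← Complex.log_im, Complex.log_exp (by nlinarith) (by nlinarith)]
end
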